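/- Define polynomials A_n ∈ ℂ[x] for n ≥ 1 by A₁ = S₁, A₂ = S₂, and A_n = S_n + A_{n−2} for n ≥ 3. Then for every integer i ≥ 3 one has the identity T_{i+2} = A_{i+2} + A_{i−2} − 2·A_i in ℂ[x]. -/

import Mathlib

open Polynomial

/-- Chebyshev polynomials of the first kind (normalization of the paper):
`T 0 = 2`, `T 1 = X`, `T (n+2) = X * T (n+1) - T n`. -/
noncomputable def chebT : ℕ → Polynomial ℂ
  | 0 => 2
  | 1 => X
  | (n + 2) => X * chebT (n + 1) - chebT n

/-- Chebyshev polynomials of the second kind: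
`S 0 = 1`, `S 1 = X`, `S (n+2) = X * S (n+1) - S n`. -/
noncomputable def chebS : ℕ → Polynomial ℂ
  | 0 => 1
  | 1 => X
  | (n + 2) => X * chebS (n + 1) - chebS n

/-- The polynomials `A n` of the paper: `A 1 = S 1`, `A 2 = S 2`, and
`A n = S n + A (n - 2)` for `n ≥ 3` (the value at `0` is irrelevant and set to `0`). -/
noncomputable def chebA : ℕ → Polynomial ℂ
  | 0 => 0
  | 1 => chebS 1
  | 2 => chebS 2
  | (n + 3) => chebS (n + 3) + chebA (n + 1)

theorem chebT_add_two (n : ℕ) : chebT (n + 2) = chebS (n + 2) - chebS n := by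
  induction n using Nat.twoStepInduction with
  | zero => simp only [chebT, chebS]; ring
  | one => simp only [chebT, chebS]; ring
  | more n ih₀ ih₁ =>
    rw [chebT, ih₁, ih₀, chebS.eq_3 (n + 2), chebS.eq_3 n]
    ring

/-- For every integer `i ≥ 3` one has the identity
`T (i+2) = A (i+2) + A (i-2) - 2 * A i` in `ℂ[x]`. -/
theorem stmt_7 (i : ℕ) (hi : 3 ≤ i) :
    chebT (i + 2) = chebA (i + 2) + chebA (i - 2) - 2 * chebA i := by
  obtain ⟨k, rfl⟩ := Nat.exists_eq_add_of_le' hi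
  rw [chebT_add_two, show k + 3 - 2 = k + 1 by omega, chebA.eq_4 (k + 2), chebA.eq_4 k]
  ring
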